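/- Let G₁, …, G_n (n ≥ 2) be connected 1-scale graphs with distinguished vertices (v_i, w_i), and let c(G₁,…,G_n) be a circular join obtained by identifying v_i with w_{i+1} cyclically. Then ψ_{c(G₁,…,G_n)} = Σ_{i=1}^n φ_{G_i} Π_{j≠i} ψ_{G_j}, where φ_{G_i} = ψ_{G_i•}. The proof follows from the bijection between spanning trees of the circular join and the disjoint union over i of products T(G₁) × ⋯ × T(G_i•) × ⋯ × T(G_n). -/

import Mathlib

open MvPolynomial

/-- A (multi)graph with vertex type `V` and labelled edge type `E`; each edge has two
(not necessarily distinct) endpoints. -/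
structure FeynGraph where
  V : Type
  E : Type
  src : E → V
  tgt : E → V

namespace FeynGraph

variable (G : FeynGraph)

/-- One step along an edge belonging to the edge set `F`. -/
def Step (F : Set G.E) (u v : G.V) : Prop :=
  ∃ e ∈ F, (G.src e = u ∧ G.tgt e = v) ∨ (G.src e = v ∧ G.tgt e = u)

/-- `u` and `v` are joined by a walk using only edges in `F`. -/
def Conn (F : Set G.E) (u v : G.V) : Prop :=
  Relation.ReflTransGen (G.Step F) u v

/-- The number of connected components of the spanning subgraph with edge set `F`
(on the full vertex set of `G`). -/
noncomputable def ncomp (F : Set G.E) : ℕ :=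
  Nat.card (Quot (G.Conn F))

/-- `G` is connected. -/
def IsConnected : Prop := ∀ u v : G.V, G.Conn Set.univ u v

/-- The loop number (first Betti number) `h = |F| + c(F) - |V|` of the spanning subgraph
with edge set `F`. -/
noncomputable def loops (F : Set G.E) : ℕ :=
  Nat.card F + G.ncomp F - Nat.card G.V

/-- A maximal spanning forest: an edge set inducing the same connectivity relation as the
whole graph, of cardinality `|V| - c(G)` (hence acyclic, one spanning tree in each
connected component; a spanning tree when `G` is connected). -/
def IsSpanningForest (T : Finset G.E) : Prop :=
  (∀ u v : G.V, G.Conn ↑T u v ↔ G.Conn Set.univ u v) ∧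
    T.card + G.ncomp Set.univ = Nat.card G.V

open Classical in
/-- The first Symanzik (Kirchhoff) polynomial `ψ_G = Σ_T Π_{e ∉ T} A_e`, the sum being
over maximal spanning forests (spanning trees, for `G` connected); for a disjoint union
this is the product of the graph polynomials of the components. -/
noncomputable def psi [Finite G.E] : MvPolynomial G.E ℝ :=
  letI := Fintype.ofFinite G.E
  ∑ T : Finset G.E, if G.IsSpanningForest T then ∏ e ∈ Tᶜ, X e else 0

/-- The subgraph of `G` with edge set `F` (on the full vertex set). -/
def restrict (F : Set G.E) : FeynGraph where
  V := G.V
  E := {e : G.E // e ∈ F}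
  src := fun e => G.src e.1
  tgt := fun e => G.tgt e.1

/-- The contraction `G/F`: every edge of `F` is contracted to a point. -/
def contract (F : Set G.E) : FeynGraph where
  V := Quot (G.Conn F)
  E := {e : G.E // e ∉ F}
  src := fun e => Quot.mk _ (G.src e.1)
  tgt := fun e => Quot.mk _ (G.tgt e.1)

/-- The graph `G•` obtained from `G` by identifying the two vertices `v₁` and `v₂`. -/
def ident (v₁ v₂ : G.V) : FeynGraph where
  V := Quot (fun a b : G.V => a = v₁ ∧ b = v₂)
  E := G.E
  src := fun e => Quot.mk _ (G.src e)
  tgt := fun e => Quot.mk _ (G.tgt e)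

/-- The graph `Ḡ` obtained from `G` by adding a new edge joining `v₁` and `v₂`
(the new edge being labelled `none`). -/
def addEdge (v₁ v₂ : G.V) : FeynGraph where
  V := G.V
  E := Option G.E
  src := fun e => e.elim v₁ G.src
  tgt := fun e => e.elim v₂ G.tgt


instance [Finite G.E] (F : Set G.E) : Finite (G.restrict F).E :=
  inferInstanceAs (Finite {e : G.E // e ∈ F})

instance [Finite G.E] (F : Set G.E) : Finite (G.contract F).E :=
  inferInstanceAs (Finite {e : G.E // e ∉ F})

instance [Finite G.V] (F : Set G.E) : Finite (G.contract F).V :=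
  inferInstanceAs (Finite (Quot (G.Conn F)))

instance [Finite G.E] (v₁ v₂ : G.V) : Finite (G.ident v₁ v₂).E :=
  inferInstanceAs (Finite G.E)

instance [Finite G.V] (v₁ v₂ : G.V) : Finite (G.ident v₁ v₂).V :=
  inferInstanceAs (Finite (Quot _))

instance [Finite G.E] (v₁ v₂ : G.V) : Finite (G.addEdge v₁ v₂).E :=
  letI := Fintype.ofFinite G.E
  inferInstanceAs (Finite (Option G.E))

instance [Finite G.V] (v₁ v₂ : G.V) : Finite (G.addEdge v₁ v₂).V :=
  inferInstanceAs (Finite G.V)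

end FeynGraph

namespace FeynGraph

/-- A circular join of the 1-scale graphs `G₁, …, G_n`: glue them in a circle by
identifying the distinguished vertex `v i` of `G i` with the distinguished vertex
`w (i+1)` of `G (i+1)`, cyclically. -/
def circJoin (n : ℕ) [NeZero n] (Gs : Fin n → FeynGraph)
    (v w : ∀ i, (Gs i).V) : FeynGraph where
  V := Quot (fun a b : Σ i, (Gs i).V =>
        ∃ i : Fin n, a = ⟨i, v i⟩ ∧ b = ⟨i + 1, w (i + 1)⟩)
  E := Σ i, (Gs i).E
  src := fun e => Quot.mk _ ⟨e.1, (Gs e.1).src e.2⟩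
  tgt := fun e => Quot.mk _ ⟨e.1, (Gs e.1).tgt e.2⟩

instance (n : ℕ) [NeZero n] (Gs : Fin n → FeynGraph) [∀ i, Finite (Gs i).E]
    (v w : ∀ i, (Gs i).V) : Finite (circJoin n Gs v w).E :=
  inferInstanceAs (Finite (Σ i, (Gs i).E))

end FeynGraph

namespace FeynGraph

section Connectivity

variable {G : FeynGraph} {F : Set G.E}

lemma Step.symm {u v : G.V} (h : G.Step F u v) : G.Step F v u := by
  obtain ⟨e, he, h⟩ := h
  exact ⟨e, he, h.symm⟩

lemma Conn.symm {u v : G.V} (h : G.Conn F u v) : G.Conn F v u :=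
  (@Relation.ReflTransGen.stdSymm _ _ ⟨fun _ _ => Step.symm⟩).symm _ _ h

lemma Conn.trans {u v x : G.V} (h : G.Conn F u v) (h' : G.Conn F v x) : G.Conn F u x :=
  Relation.ReflTransGen.trans h h'

lemma Conn.edge {e : G.E} (he : e ∈ F) : G.Conn F (G.src e) (G.tgt e) :=
  Relation.ReflTransGen.single ⟨e, he, Or.inl ⟨rfl, rfl⟩⟩

lemma Conn.congr_right {e : G.E} (he : e ∈ F) (x : G.V) :
    G.Conn F x (G.src e) ↔ G.Conn F x (G.tgt e) :=
  ⟨fun h => h.trans (Conn.edge he), fun h => h.trans (Conn.edge he).symm⟩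

lemma Conn.congr_left {e : G.E} (he : e ∈ F) (x : G.V) :
    G.Conn F (G.src e) x ↔ G.Conn F (G.tgt e) x :=
  ⟨fun h => (Conn.edge he).symm.trans h, fun h => (Conn.edge he).trans h⟩

/-- A vertex property constant along the edges of `F` is constant on connected components. -/
lemma Conn.iff_of_invariant {P : G.V → Prop} (hP : ∀ e ∈ F, P (G.src e) ↔ P (G.tgt e))
    {u v : G.V} (h : G.Conn F u v) : P u ↔ P v := by
  induction h with
  | refl => rfl
  | tail _ hs ih =>
    obtain ⟨e, he, ⟨rfl, rfl⟩ | ⟨rfl, rfl⟩⟩ := hs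
    · exact ih.trans (hP e he)
    · exact ih.trans (hP e he).symm

/-- Connectivity is preserved by graph homomorphisms. -/
lemma Conn.map {H : FeynGraph} {F' : Set H.E} (f : G.V → H.V) (g : G.E → H.E)
    (hsrc : ∀ e, H.src (g e) = f (G.src e)) (htgt : ∀ e, H.tgt (g e) = f (G.tgt e))
    (hF : ∀ e ∈ F, g e ∈ F') {u v : G.V} (h : G.Conn F u v) : H.Conn F' (f u) (f v) := by
  refine Relation.ReflTransGen.lift f ?_ _ _ h
  rintro a b ⟨e, he, ⟨rfl, rfl⟩ | ⟨rfl, rfl⟩⟩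
  · exact ⟨g e, hF e he, Or.inl ⟨hsrc e, htgt e⟩⟩
  · exact ⟨g e, hF e he, Or.inr ⟨hsrc e, htgt e⟩⟩

/-- A connected spanning subgraph has at least `|V| - 1` edges. -/
lemma card_le_card_add_one [Nonempty G.V] {T : Finset G.E}
    (h : ∀ u v, G.Conn (↑T : Set G.E) u v) : Nat.card G.V ≤ T.card + 1 := by
  classical
  let S : SimpleGraph G.V := SimpleGraph.fromRel (G.Step ↑T)
  have hS : S.Connected := by
    rw [SimpleGraph.connected_iff]
    refine ⟨fun u v => ?_, inferInstance⟩
    have huv := h u v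
    induction huv with
    | refl => exact SimpleGraph.Reachable.refl _
    | @tail b c _ hs ih =>
      by_cases hbc : b = c
      · exact hbc ▸ ih
      · exact ih.trans (SimpleGraph.Adj.reachable
          ((SimpleGraph.fromRel_adj _ _ _).2 ⟨hbc, Or.inl hs⟩))
  have hsub : S.edgeSet ⊆ ↑(T.image fun e => s(G.src e, G.tgt e)) := by
    intro x
    induction x with
    | _ a b =>
      rw [SimpleGraph.mem_edgeSet, SimpleGraph.fromRel_adj]
      rintro ⟨-, hs | hs⟩ <;> obtain ⟨e, he, ⟨rfl, rfl⟩ | ⟨rfl, rfl⟩⟩ := hs <;>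
        simp only [Finset.coe_image, Set.mem_image] <;>
        first
          | exact ⟨e, he, rfl⟩
          | exact ⟨e, he, Sym2.eq_swap⟩
  have hle : Nat.card S.edgeSet ≤ T.card := by
    calc Nat.card S.edgeSet = S.edgeSet.ncard := rfl
      _ ≤ (↑(T.image fun e => s(G.src e, G.tgt e)) : Set (Sym2 G.V)).ncard :=
        Set.ncard_le_ncard hsub (Finset.finite_toSet _)
      _ ≤ T.card := by
        rw [Set.ncard_coe_finset]
        exact Finset.card_image_le
  exact hS.card_vert_le_card_edgeSet_add_one.trans (by omega)

lemma IsConnected.isSpanningForest_iff [Nonempty G.V] (hG : G.IsConnected) (T : Finset G.E) :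
    G.IsSpanningForest T ↔
      (∀ u v, G.Conn (↑T : Set G.E) u v) ∧ T.card + 1 = Nat.card G.V := by
  have h1 : G.ncomp Set.univ = 1 := by
    rw [ncomp, Nat.card_eq_one_iff_unique]
    refine ⟨⟨fun a b => ?_⟩, ⟨Quot.mk _ (Classical.arbitrary _)⟩⟩
    induction a using Quot.ind
    induction b using Quot.ind
    exact Quot.sound (hG _ _)
  rw [IsSpanningForest, h1]
  exact and_congr_left fun _ =>
    forall₂_congr fun u v => ⟨fun h => h.2 (hG u v), fun h => ⟨fun _ => hG u v, fun _ => h⟩⟩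

end Connectivity

section Ident

variable {G : FeynGraph} {v w : G.V}

lemma ident_conn_iff (F : Set G.E) :
    (∀ a b, (G.ident v w).Conn F a b) ↔ ∀ x, G.Conn F x v ∨ G.Conn F x w := by
  constructor
  · intro h x
    let P : (G.ident v w).V → Prop :=
      Quot.lift (fun x => G.Conn F x v ∨ G.Conn F x w) (by
        rintro a b ⟨rfl, rfl⟩
        exact propext (iff_of_true (Or.inl .refl) (Or.inr .refl)))
    have hP : ∀ e ∈ F, P ((G.ident v w).src e) ↔ P ((G.ident v w).tgt e) := fun e he =>
      or_congr (Conn.congr_left he v) (Conn.congr_left he w)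
    exact ((h (Quot.mk _ x) (Quot.mk _ v)).iff_of_invariant hP).2 (Or.inl .refl)
  · intro h
    have key : ∀ a, (G.ident v w).Conn F a (Quot.mk _ v) := by
      intro a
      induction a using Quot.ind with
      | _ x =>
        have lift : ∀ {x y}, G.Conn F x y →
            (G.ident v w).Conn F (Quot.mk _ x) (Quot.mk _ y) := fun hc =>
          Conn.map (H := G.ident v w) (Quot.mk _) id (fun _ => rfl) (fun _ => rfl)
            (fun _ he => he) hc
        rcases h x with hx | hx
        · exact lift hx
        · have hvw : (Quot.mk _ v : (G.ident v w).V) = Quot.mk _ w := Quot.sound ⟨rfl, rfl⟩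
          rw [hvw]
          exact lift hx
    exact fun a b => (key a).trans (key b).symm

lemma card_ident [Finite G.V] (hne : v ≠ w) :
    Nat.card (G.ident v w).V + 1 = Nat.card G.V := by
  classical
  have e : (G.ident v w).V ≃ {x : G.V // x ≠ v} :=
    { toFun := Quot.lift (fun x => if h : x = v then ⟨w, hne.symm⟩ else ⟨x, h⟩) (by
        rintro a b ⟨rfl, rfl⟩
        simp [hne.symm])
      invFun := fun x => Quot.mk _ x.1
      left_inv := by
        intro a
        induction a using Quot.ind with
        | _ x =>
          by_cases h : x = v
          · exact (congrArg (fun y : {x : G.V // x ≠ v} => Quot.mk _ y.1) (dif_pos h)).trans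
              (Quot.sound ⟨h, rfl⟩).symm
          · exact congrArg (fun y : {x : G.V // x ≠ v} => Quot.mk _ y.1) (dif_neg h)
      right_inv := fun x => by simp [x.2] }
  rw [Nat.card_congr e]
  have := Fintype.ofFinite G.V
  rw [Nat.card_eq_fintype_card, Nat.card_eq_fintype_card, Fintype.card_subtype_compl,
    Fintype.card_subtype_eq]
  have : 0 < Fintype.card G.V := Fintype.card_pos_iff.2 ⟨v⟩
  omega

end Ident

/-- A nonempty subset of the cyclic index set closed under `+ 1` is everything. -/
lemma fin_cyclic_induction {n : ℕ} [NeZero n] {P : Fin n → Prop} (i : Fin n) (hi : P i)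
    (hstep : ∀ m, P m → P (m + 1)) (m : Fin n) : P m := by
  have key : ∀ k : ℕ, P (i + Fin.ofNat n k) := by
    intro k
    induction k with
    | zero => simpa using hi
    | succ k ih =>
      have h := hstep _ ih
      have e : i + Fin.ofNat n k + 1 = i + Fin.ofNat n (k + 1) := by
        rw [add_assoc]
        congr 1
        ext
        simp [Fin.val_add]
      rwa [e] at h
  have h := key (m - i).val
  simpa using h

section CircJoin

variable {n : ℕ} [NeZero n] {Gs : Fin n → FeynGraph} {v w : ∀ i, (Gs i).V}

/-- The vertex of a circular join coming from the vertex `x` of the `i`-th piece. -/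
def circVert (v w : ∀ i, (Gs i).V) (i : Fin n) (x : (Gs i).V) : (circJoin n Gs v w).V :=
  Quot.mk _ ⟨i, x⟩

/-- The edge set of a circular join made of edge sets of the pieces. -/
def circEdges (v w : ∀ i, (Gs i).V) (F : ∀ i, Set (Gs i).E) : Set (circJoin n Gs v w).E :=
  {e : Σ i, (Gs i).E | e.2 ∈ F e.1}

lemma circVert_glue (i : Fin n) : circVert v w i (v i) = circVert v w (i + 1) (w (i + 1)) :=
  Quot.sound ⟨i, rfl, rfl⟩

lemma Conn.circJoin {F : ∀ i, Set (Gs i).E} {i : Fin n} {x y : (Gs i).V}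
    (h : (Gs i).Conn (F i) x y) :
    (circJoin n Gs v w).Conn (circEdges v w F) (circVert v w i x) (circVert v w i y) :=
  Conn.map (H := FeynGraph.circJoin n Gs v w) (circVert v w i) (fun e => ⟨i, e⟩)
    (fun _ => rfl) (fun _ => rfl) (fun _ he => he) h

/-- Transfer of a property of vertices of the pieces along connectivity in a circular join. -/
lemma Conn.iff_of_circJoin_invariant {F : ∀ i, Set (Gs i).E} (P : ∀ i, (Gs i).V → Prop)
    (hglue : ∀ i, P i (v i) ↔ P (i + 1) (w (i + 1)))
    (hP : ∀ i, ∀ e ∈ F i, P i ((Gs i).src e) ↔ P i ((Gs i).tgt e))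
    {i j : Fin n} {x : (Gs i).V} {y : (Gs j).V}
    (h : (FeynGraph.circJoin n Gs v w).Conn (circEdges v w F)
      (circVert v w i x) (circVert v w j y)) : P i x ↔ P j y := by
  let Q : (FeynGraph.circJoin n Gs v w).V → Prop :=
    Quot.lift (fun a : Σ i, (Gs i).V => P a.1 a.2) (by
      rintro a b ⟨i, rfl, rfl⟩
      exact propext (hglue i))
  exact h.iff_of_invariant (P := Q) fun e he => hP e.1 e.2 he

lemma circJoin_conn_of {F : ∀ i, Set (Gs i).E} (i : Fin n)
    (hi : ∀ x, (Gs i).Conn (F i) x (v i) ∨ (Gs i).Conn (F i) x (w i))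
    (hj : ∀ j, j ≠ i → ∀ x y, (Gs j).Conn (F j) x y) (a b) :
    (circJoin n Gs v w).Conn (circEdges v w F) a b := by
  have hw : ∀ m, (circJoin n Gs v w).Conn (circEdges v w F)
      (circVert v w m (w m)) (circVert v w i (v i)) := by
    refine fin_cyclic_induction (i + 1) ?_ fun m hm => ?_
    · rw [circVert_glue i]
      exact .refl
    · rw [← circVert_glue m]
      by_cases h : m = i
      · subst h
        exact .refl
      · exact (Conn.circJoin (hj m h _ _)).trans hm
  have key : ∀ a, (circJoin n Gs v w).Conn (circEdges v w F) a (circVert v w i (v i)) := by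
    intro a
    induction a using Quot.ind with
    | _ a =>
      obtain ⟨m, x⟩ := a
      by_cases h : m = i
      · subst h
        rcases hi x with hx | hx
        · exact hx.circJoin
        · exact hx.circJoin.trans (hw m)
      · exact (Conn.circJoin (hj m h x (w m))).trans (hw m)
  exact (key a).trans (key b).symm

lemma conn_or_conn_of_circJoin {F : ∀ i, Set (Gs i).E}
    (h : ∀ a b, (circJoin n Gs v w).Conn (circEdges v w F) a b) (i : Fin n) (x : (Gs i).V) :
    (Gs i).Conn (F i) x (v i) ∨ (Gs i).Conn (F i) x (w i) := by
  refine (Conn.iff_of_circJoin_invariant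
    (fun i x => (Gs i).Conn (F i) x (v i) ∨ (Gs i).Conn (F i) x (w i))
    (fun i => iff_of_true (Or.inl .refl) (Or.inr .refl))
    (fun i e he => or_congr (Conn.congr_left he _) (Conn.congr_left he _))
    (h (circVert v w i x) (circVert v w i (v i)))).2 (Or.inl .refl)

/-- Cutting a circular join in two different pieces disconnects it. -/
lemma conn_or_conn_of_circJoin_of_lt {F : ∀ i, Set (Gs i).E}
    (h : ∀ a b, (circJoin n Gs v w).Conn (circEdges v w F) a b) {i j : Fin n} (hij : i < j) :
    (Gs i).Conn (F i) (w i) (v i) ∨ (Gs j).Conn (F j) (w j) (v j) := by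
  by_contra! hcut
  obtain ⟨hi, hj⟩ := hcut
  let P : ∀ k, (Gs k).V → Prop := fun k x =>
    (i < k ∧ k < j) ∨ (k = i ∧ ¬ (Gs k).Conn (F k) (w k) x) ∨
      (k = j ∧ (Gs k).Conn (F k) (w k) x)
  have hPw : ∀ k, P k (w k) ↔ i < k ∧ k ≤ j := by
    intro k
    have hr : (Gs k).Conn (F k) (w k) (w k) := .refl
    simp only [P, hr, not_true_eq_false, and_false, false_or, and_true]
    omega
  have hPv : ∀ k, P k (v k) ↔ i ≤ k ∧ k < j := by
    intro k
    by_cases h1 : k = i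
    · subst h1
      simp [P, hi, hij]
    by_cases h2 : k = j
    · subst h2
      simp [P, hj, h1]
    simp only [P, h1, h2, false_and, or_false]
    omega
  have hglue : ∀ k, P k (v k) ↔ P (k + 1) (w (k + 1)) := by
    intro k
    rw [hPv, hPw]
    have hk := k.isLt
    have hjn := j.isLt
    simp only [Fin.lt_def, Fin.le_def] at hij ⊢
    by_cases hlast : k.val + 1 = n
    · have : (k + 1 : Fin n).val = 0 := by simp [Fin.val_add, hlast]
      omega
    · have : (k + 1 : Fin n).val = k.val + 1 := by
        rw [Fin.val_add, Fin.val_one', Nat.add_mod_mod, Nat.mod_eq_of_lt (by omega)]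
      omega
  have hinv := Conn.iff_of_circJoin_invariant P hglue
    (fun k e he => or_congr Iff.rfl (or_congr
      (and_congr Iff.rfl (not_congr (Conn.congr_right he _)))
      (and_congr Iff.rfl (Conn.congr_right he _))))
    (h (circVert v w i (v i)) (circVert v w i (w i)))
  rw [hPv, hPw] at hinv
  exact lt_irrefl i (hinv.1 ⟨le_rfl, hij⟩).1

lemma conn_or_conn_of_circJoin_of_ne {F : ∀ i, Set (Gs i).E}
    (h : ∀ a b, (circJoin n Gs v w).Conn (circEdges v w F) a b) {i j : Fin n} (hij : i ≠ j) :
    (Gs i).Conn (F i) (w i) (v i) ∨ (Gs j).Conn (F j) (w j) (v j) := by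
  rcases lt_or_gt_of_ne hij with hlt | hlt
  · exact conn_or_conn_of_circJoin_of_lt h hlt
  · exact (conn_or_conn_of_circJoin_of_lt h hlt).symm

lemma card_circJoin [∀ i, Finite (Gs i).V] (hne : ∀ i, v i ≠ w i) :
    Nat.card (circJoin n Gs v w).V + n = ∑ i, Nat.card (Gs i).V := by
  classical
  have e : (circJoin n Gs v w).V ≃ Σ i, {x : (Gs i).V // x ≠ v i} :=
    { toFun := Quot.lift (fun a => if h : a.2 = v a.1
          then ⟨a.1 + 1, w (a.1 + 1), (hne _).symm⟩ else ⟨a.1, a.2, h⟩) (by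
        rintro a b ⟨i, rfl, rfl⟩
        simp [(hne _).symm])
      invFun := fun x => Quot.mk _ ⟨x.1, x.2.1⟩
      left_inv := by
        intro a
        induction a using Quot.ind with
        | _ a =>
          obtain ⟨k, x⟩ := a
          by_cases h : x = v k
          · subst h
            exact (congrArg (fun y : Σ i, {x : (Gs i).V // x ≠ v i} => circVert v w y.1 y.2.1)
              (dif_pos rfl)).trans (circVert_glue k).symm
          · exact congrArg (fun y : Σ i, {x : (Gs i).V // x ≠ v i} => circVert v w y.1 y.2.1)
              (dif_neg h)
      right_inv := fun x => by simp [x.2.2] }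
  have := fun i => Fintype.ofFinite (Gs i).V
  rw [Nat.card_congr e, Nat.card_sigma]
  have hcard : ∀ i, Nat.card (Gs i).V = Nat.card {x : (Gs i).V // x ≠ v i} + 1 := by
    intro i
    rw [Nat.card_eq_fintype_card, Nat.card_eq_fintype_card, Fintype.card_subtype_compl,
      Fintype.card_subtype_eq]
    have : 0 < Fintype.card (Gs i).V := Fintype.card_pos_iff.2 ⟨v i⟩
    omega
  simp only [hcard, Finset.sum_add_distrib, Finset.sum_const, Finset.card_univ, Fintype.card_fin,
    smul_eq_mul, mul_one]

/-- The finite edge set of a circular join made of finite edge sets of the pieces. -/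
def circFinset (v w : ∀ i, (Gs i).V) (p : ∀ i, Finset (Gs i).E) :
    Finset (circJoin n Gs v w).E :=
  (Finset.univ.sigma p : Finset (Σ i, (Gs i).E))

lemma coe_circFinset (p : ∀ i, Finset (Gs i).E) :
    (↑(circFinset v w p) : Set (circJoin n Gs v w).E) = circEdges v w fun i => ↑(p i) :=
  Set.ext fun e => Finset.mem_coe.trans <|
    (Finset.mem_sigma (s := Finset.univ) (t := p) (a := e)).trans
      (and_iff_right (Finset.mem_univ _))

lemma card_circFinset (p : ∀ i, Finset (Gs i).E) :
    (circFinset v w p).card = ∑ i, (p i).card :=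
  Finset.card_sigma _ _

lemma IsConnected.ident {G : FeynGraph} (hG : G.IsConnected) (a b : G.V) :
    (G.ident a b).IsConnected :=
  (ident_conn_iff Set.univ).2 fun x => Or.inl (hG x a)

lemma IsConnected.circJoin (hconn : ∀ i, (Gs i).IsConnected) :
    (circJoin n Gs v w).IsConnected :=
  circJoin_conn_of (F := fun _ => Set.univ) 0 (fun x => Or.inl (hconn 0 x _))
    fun j _ => hconn j

lemma IsConnected.isSpanningForest_ident_iff {G : FeynGraph} [Finite G.V] {a b : G.V}
    (hab : a ≠ b) (hG : G.IsConnected) (T : Finset G.E) :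
    (G.ident a b).IsSpanningForest T ↔
      (∀ x, G.Conn (↑T : Set G.E) x a ∨ G.Conn (↑T : Set G.E) x b) ∧
        T.card + 2 = Nat.card G.V := by
  have : Nonempty (G.ident a b).V := ⟨Quot.mk _ a⟩
  refine ((hG.ident a b).isSpanningForest_iff _).trans (and_congr (ident_conn_iff _) ?_)
  rw [← card_ident hab]
  exact Nat.succ_inj.symm

/-- The spanning trees of a circular join are made of a spanning tree of `G_i•` for one `i`
and spanning trees of the other pieces. -/
lemma isSpanningForest_circJoin_iff [∀ i, Finite (Gs i).V] (hconn : ∀ i, (Gs i).IsConnected)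
    (hne : ∀ i, v i ≠ w i) (p : ∀ i, Finset (Gs i).E) :
    (circJoin n Gs v w).IsSpanningForest (circFinset v w p) ↔
      ∃ i, ((Gs i).ident (v i) (w i)).IsSpanningForest (p i) ∧
        ∀ j, j ≠ i → (Gs j).IsSpanningForest (p j) := by
  classical
  have : ∀ i, Nonempty (Gs i).V := fun i => ⟨v i⟩
  have : Nonempty (circJoin n Gs v w).V := ⟨circVert v w 0 (v 0)⟩
  have hV := card_circJoin hne
  have hsplit : ∀ (f : Fin n → ℕ) i, ∑ j, f j = f i + ∑ j ∈ Finset.univ.erase i, f j :=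
    fun f i => (Finset.add_sum_erase _ f (Finset.mem_univ i)).symm
  have hone : ∀ i : Fin n, (Finset.univ.erase i).card + 1 = n := fun i => by
    rw [Finset.card_erase_add_one (Finset.mem_univ i), Finset.card_univ, Fintype.card_fin]
  rw [(IsConnected.circJoin hconn).isSpanningForest_iff, coe_circFinset, card_circFinset]
  refine Iff.trans ?_ (exists_congr fun i => and_congr
    ((hconn i).isSpanningForest_ident_iff (hne i) (p i))
    (forall₂_congr fun j _ => (hconn j).isSpanningForest_iff (p j))).symm
  constructor
  · rintro ⟨hspan, hcard⟩
    have hor := conn_or_conn_of_circJoin hspan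
    have hfull : ∀ i, (Gs i).Conn (↑(p i) : Set (Gs i).E) (w i) (v i) →
        ∀ x y, (Gs i).Conn (↑(p i) : Set (Gs i).E) x y := by
      intro i h x y
      have key : ∀ x, (Gs i).Conn (↑(p i) : Set (Gs i).E) x (v i) := fun x =>
        (hor i x).elim id fun hx => hx.trans h
      exact (key x).trans (key y).symm
    obtain ⟨i, hi⟩ : ∃ i, ¬ (Gs i).Conn (↑(p i) : Set (Gs i).E) (w i) (v i) := by
      by_contra! hall
      have hle : ∑ i, Nat.card (Gs i).V ≤ ∑ i, ((p i).card + 1) :=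
        Finset.sum_le_sum fun i _ => card_le_card_add_one (hfull i (hall i))
      rw [Finset.sum_add_distrib] at hle
      simp only [Finset.sum_const, Finset.card_univ, Fintype.card_fin, smul_eq_mul, mul_one] at hle
      omega
    have hj : ∀ j, j ≠ i → ∀ x y, (Gs j).Conn (↑(p j) : Set (Gs j).E) x y := fun j hji =>
      hfull j ((conn_or_conn_of_circJoin_of_ne hspan hji).resolve_right hi)
    have hlei : Nat.card (Gs i).V ≤ (p i).card + 2 := by
      have : Nonempty ((Gs i).ident (v i) (w i)).V := ⟨Quot.mk _ (v i)⟩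
      have h : Nat.card ((Gs i).ident (v i) (w i)).V ≤ (p i).card + 1 :=
        card_le_card_add_one (G := (Gs i).ident (v i) (w i)) ((ident_conn_iff _).2 (hor i))
      rw [← card_ident (hne i)]
      omega
    have hlej : ∀ j ∈ Finset.univ.erase i, Nat.card (Gs j).V ≤ (p j).card + 1 := fun j hji =>
      card_le_card_add_one (hj j (Finset.ne_of_mem_erase hji))
    have hsum := Finset.sum_le_sum hlej
    have hV' := hsplit (fun j => Nat.card (Gs j).V) i
    have hT' := hsplit (fun j => (p j).card) i
    have hn := hone i
    have hadd : ∑ j ∈ Finset.univ.erase i, ((p j).card + 1) =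
        ∑ j ∈ Finset.univ.erase i, (p j).card + (Finset.univ.erase i).card := by
      simp [Finset.sum_add_distrib]
    refine ⟨i, ⟨hor i, by omega⟩, fun j hji => ⟨hj j hji, ?_⟩⟩
    exact ((Finset.sum_eq_sum_iff_of_le hlej).1 (by omega) j
      (Finset.mem_erase.2 ⟨hji, Finset.mem_univ j⟩)).symm
  · rintro ⟨i, ⟨hi, hci⟩, hj⟩
    refine ⟨circJoin_conn_of i hi fun j hji => (hj j hji).1, ?_⟩
    have hV' := hsplit (fun j => Nat.card (Gs j).V) i
    have hT' := hsplit (fun j => (p j).card) i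
    have hn := hone i
    have hadd : ∑ j ∈ Finset.univ.erase i, Nat.card (Gs j).V =
        ∑ j ∈ Finset.univ.erase i, (p j).card + (Finset.univ.erase i).card := by
      rw [Finset.sum_congr rfl fun j hji => (hj j (Finset.ne_of_mem_erase hji)).2.symm,
        Finset.sum_add_distrib]
      simp
    omega

end CircJoin

/-- The piece `i` of a spanning tree of a circular join that is cut is unique. -/
lemma eq_of_isSpanningForest_pieces {n : ℕ} {Gs : Fin n → FeynGraph}
    {v w : ∀ i, (Gs i).V} [∀ i, Finite (Gs i).V] (hconn : ∀ i, (Gs i).IsConnected)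
    (hne : ∀ i, v i ≠ w i) {p : ∀ i, Finset (Gs i).E} {i j : Fin n}
    (hi : ((Gs i).ident (v i) (w i)).IsSpanningForest (p i))
    (hj : ∀ k, k ≠ j → (Gs k).IsSpanningForest (p k)) : i = j := by
  by_contra hij
  have : Nonempty (Gs i).V := ⟨v i⟩
  have h1 := (((hconn i).isSpanningForest_ident_iff (hne i) _).1 hi).2
  have h2 := (((hconn i).isSpanningForest_iff _).1 (hj i hij)).2
  omega

open Classical in
lemma psi_eq_sum (G : FeynGraph) [Fintype G.E] [DecidableEq G.E] :
    G.psi = ∑ T : Finset G.E,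
      if G.IsSpanningForest T then ∏ e ∈ Tᶜ, (X e : MvPolynomial G.E ℝ) else 0 := by
  unfold psi
  congr!

open Classical in
lemma rename_psi (G : FeynGraph) [Fintype G.E] [DecidableEq G.E] {σ : Type} (f : G.E → σ) :
    rename f G.psi = ∑ T : Finset G.E,
      if G.IsSpanningForest T then ∏ e ∈ Tᶜ, (X (f e) : MvPolynomial σ ℝ) else 0 := by
  rw [psi_eq_sum, map_sum]
  refine Finset.sum_congr rfl fun T _ => ?_
  split_ifs <;> simp

open Classical in
lemma rename_psi_ident (G : FeynGraph) [Fintype G.E] [DecidableEq G.E]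
    (a b : G.V) {σ : Type} (f : G.E → σ) :
    rename f ((G.ident a b).psi : MvPolynomial G.E ℝ) = ∑ T : Finset G.E,
      if (G.ident a b).IsSpanningForest T then
        ∏ e ∈ Tᶜ, (X (f e) : MvPolynomial σ ℝ) else 0 :=
  @rename_psi (G.ident a b) (inferInstanceAs (Fintype G.E)) (inferInstanceAs (DecidableEq G.E)) σ f

open Classical in
lemma psi_circJoin_eq_sum {n : ℕ} [NeZero n] (Gs : Fin n → FeynGraph)
    [∀ i, Fintype (Gs i).E] [∀ i, DecidableEq (Gs i).E] (v w : ∀ i, (Gs i).V) :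
    ((circJoin n Gs v w).psi : MvPolynomial (Σ i, (Gs i).E) ℝ) =
      ∑ T : Finset (Σ i, (Gs i).E), if (circJoin n Gs v w).IsSpanningForest T then
        ∏ e ∈ Tᶜ, (X e : MvPolynomial (Σ i, (Gs i).E) ℝ) else 0 :=
  @psi_eq_sum (circJoin n Gs v w) (inferInstanceAs (Fintype (Σ i, (Gs i).E)))
    (inferInstanceAs (DecidableEq (Σ i, (Gs i).E)))

/-- Edge sets of a disjoint union correspond to families of edge sets. -/
noncomputable def finsetSigmaEquiv {ι : Type} [Fintype ι] (E : ι → Type) :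
    (∀ i, Finset (E i)) ≃ Finset (Σ i, E i) where
  toFun p := Finset.univ.sigma p
  invFun T i := T.preimage (Sigma.mk i) sigma_mk_injective.injOn
  left_inv p := by
    ext i e
    simp
  right_inv T := by
    ext ⟨i, e⟩
    simp

open Classical in
lemma mul_prod_sum_ite {ι R : Type} [Fintype ι] [DecidableEq ι] [CommSemiring R] {E : ι → Type}
    [∀ i, Fintype (E i)] (K H : ∀ i, Finset (E i) → Prop) (g : ∀ i, Finset (E i) → R) (i : ι) :
    (∑ T, if K i T then g i T else 0) *
        ∏ j ∈ Finset.univ.erase i, ∑ T, (if H j T then g j T else 0) =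
      ∑ p : ∀ i, Finset (E i),
        if K i (p i) ∧ ∀ j, j ≠ i → H j (p j) then ∏ j, g j (p j) else 0 := by
  let L : ∀ j, Finset (E j) → Prop := fun j T => if j = i then K j T else H j T
  have hi : ∀ T, K i T ↔ L i T := fun T => by simp [L]
  have hj : ∀ j ∈ Finset.univ.erase i, ∑ T, (if H j T then g j T else 0) =
      ∑ T, (if L j T then g j T else 0) := fun j hj => by
    simp [L, Finset.ne_of_mem_erase hj]
  rw [Finset.sum_congr rfl fun T _ => if_congr (hi T) rfl rfl, Finset.prod_congr rfl hj,
    Finset.mul_prod_erase Finset.univ (fun j => ∑ T, if L j T then g j T else 0)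
      (Finset.mem_univ i),
    Finset.prod_univ_sum, Fintype.piFinset_univ]
  refine Finset.sum_congr rfl fun p _ => ?_
  have key : (∀ j ∈ Finset.univ, L j (p j)) ↔ K i (p i) ∧ ∀ j, j ≠ i → H j (p j) := by
    refine ⟨fun h => ⟨(hi _).2 (h i (Finset.mem_univ i)), fun j hji => ?_⟩, fun h j _ => ?_⟩
    · simpa [L, hji] using h j (Finset.mem_univ j)
    · by_cases hji : j = i
      · subst hji
        exact (hi _).1 h.1
      · simpa [L, hji] using h.2 j hji
  rw [Finset.prod_ite_zero]
  split_ifs <;> tauto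

end FeynGraph

open FeynGraph MvPolynomial in
/-- For any circular join `c(G₁,…,G_n)` (`n ≥ 2`) of connected 1-scale graphs,
`ψ_{c(G₁,…,G_n)} = Σ_i φ_{G_i} Π_{j≠i} ψ_{G_j}` where `φ_{G_i} = ψ_{G_i•}`,
reflecting the bijection between spanning trees of the circular join and
`⋃_i T(G₁) × ⋯ × T(G_i•) × ⋯ × T(G_n)`. -/
theorem psi_circJoin (n : ℕ) [NeZero n] (hn : 2 ≤ n) (Gs : Fin n → FeynGraph)
    [∀ i, Finite (Gs i).E] [∀ i, Finite (Gs i).V]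
    (v w : ∀ i, (Gs i).V) (hconn : ∀ i, (Gs i).IsConnected) (hne : ∀ i, v i ≠ w i) :
    (FeynGraph.psi (circJoin n Gs v w) : MvPolynomial (Σ i, (Gs i).E) ℝ) =
      ∑ i : Fin n,
        (rename (Sigma.mk i)
            (FeynGraph.psi ((Gs i).ident (v i) (w i)) : MvPolynomial (Gs i).E ℝ)) *
          ∏ j ∈ Finset.univ.erase i,
            rename (Sigma.mk j) (FeynGraph.psi (Gs j)) := by
  classical
  have := fun i => Fintype.ofFinite (Gs i).E
  let c : (∀ i, Finset (Gs i).E) → MvPolynomial (Σ i, (Gs i).E) ℝ :=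
    fun p => ∏ j, ∏ e ∈ (p j)ᶜ, X ⟨j, e⟩
  let A : Fin n → (∀ i, Finset (Gs i).E) → Prop := fun i p =>
    ((Gs i).ident (v i) (w i)).IsSpanningForest (p i) ∧
      ∀ j, j ≠ i → (Gs j).IsSpanningForest (p j)
  have hterm : ∀ i : Fin n,
      (rename (Sigma.mk (β := fun i => (Gs i).E) i)
          (FeynGraph.psi ((Gs i).ident (v i) (w i)) : MvPolynomial (Gs i).E ℝ)) *
        ∏ j ∈ Finset.univ.erase i, rename (Sigma.mk j) (FeynGraph.psi (Gs j)) =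
      ∑ p : ∀ i, Finset (Gs i).E, if A i p then c p else 0 := by
    intro i
    refine Eq.trans ?_ ((mul_prod_sum_ite (E := fun i => (Gs i).E)
      (fun i T => ((Gs i).ident (v i) (w i)).IsSpanningForest T)
      (fun i T => (Gs i).IsSpanningForest T)
      (fun j T => ∏ e ∈ Tᶜ, (X ⟨j, e⟩ : MvPolynomial (Σ i, (Gs i).E) ℝ)) i).trans
      (Finset.sum_congr rfl fun p _ => by congr!))
    refine congrArg₂ (· * ·) ?_ (Finset.prod_congr rfl fun j _ => ?_)
    · exact rename_psi_ident (Gs i) (v i) (w i) (Sigma.mk (β := fun i => (Gs i).E) i)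
    · exact rename_psi (Gs j) (Sigma.mk (β := fun i => (Gs i).E) j)
  have hlhs : (FeynGraph.psi (circJoin n Gs v w) : MvPolynomial (Σ i, (Gs i).E) ℝ) =
      ∑ p : ∀ i, Finset (Gs i).E, if ∃ i, A i p then c p else 0 := by
    refine (psi_circJoin_eq_sum Gs v w).trans ?_
    refine (Fintype.sum_equiv (finsetSigmaEquiv fun i => (Gs i).E) _ _ fun p => ?_).symm
    refine if_congr (isSpanningForest_circJoin_iff hconn hne p).symm ?_ rfl
    have hcompl : (finsetSigmaEquiv (fun i => (Gs i).E) p)ᶜ =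
        Finset.univ.sigma fun i => (p i)ᶜ := by
      ext ⟨i, e⟩
      simp [finsetSigmaEquiv]
    refine (Finset.prod_sigma _ (fun i => (p i)ᶜ)
      (fun e => (X e : MvPolynomial (Σ i, (Gs i).E) ℝ))).symm.trans ?_
    rw [← hcompl]
  refine hlhs.trans (Eq.symm ((Finset.sum_congr rfl fun i _ => hterm i).trans ?_))
  rw [Finset.sum_comm]
  refine Finset.sum_congr rfl fun p _ => Eq.symm ?_
  split_ifs with h
  · obtain ⟨i, hi⟩ := h
    rw [Finset.sum_eq_single i, if_pos hi]
    · exact fun j _ hji => if_neg fun hj =>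
        hji (eq_of_isSpanningForest_pieces hconn hne hj.1 hi.2)
    · exact fun h => absurd (Finset.mem_univ i) h
  · exact (Finset.sum_eq_zero fun i _ => if_neg fun hi => h ⟨i, hi⟩).symm
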